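/- Let (C^n, δ_n, η_n) be a twisted complex over ℝ, and let B_n : C^n → C^{n+2} be linear maps. Define E_n : C^n → C^{n+3} by E := δ ∘ B − B ∘ δ, and assume η ∘ B = B ∘ η and E ∘ B = B ∘ E. Then: (i) the operator exp(B) := Σ_{k≥0} B^k / k! is a well-defined ℝ-linear automorphism of the completion Ĉ = ∏_{n∈ℕ} C^n (in each component the sum is finite, since B raises degree by 2, and exp(−B) is a two-sided inverse); (ii) (δ + η) ∘ exp(B) = exp(B) ∘ (δ + η + E) as operators on Ĉ; (iii) consequently (δ + η + E)² = 0 and exp(B) induces an ℝ-linear isomorphism ker(δ+η+E)/im(δ+η+E) ≅ ker(δ+η)/im(δ+η). (Abstract form of Lemma 2.12 of the paper: twisting forms differing by an exact form d_G b give isomorphic twisted cohomology, via wedging with exp(b).) -/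

import Mathlib

/-- The twisted differential `D = δ + η` on the completion `Ĉ = ∏ n, C n`. -/
def twistedD (C : ℕ → Type) [∀ n, AddCommGroup (C n)] [∀ n, Module ℝ (C n)]
    (δ : ∀ n, C n →ₗ[ℝ] C (n + 1)) (η : ∀ n, C n →ₗ[ℝ] C (n + 3))
    (c : ∀ n, C n) : ∀ n, C n := fun n =>
  match n with
  | 0 => 0
  | 1 => δ 0 (c 0)
  | 2 => δ 1 (c 1)
  | (m + 3) => δ (m + 2) (c (m + 2)) + η m (c m)

/-- The degree `+2` operator on `Ĉ` induced by a family `B_n : C^n → C^{n+2}`. -/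
def shift2 (C : ℕ → Type) [∀ n, AddCommGroup (C n)] [∀ n, Module ℝ (C n)]
    (B : ∀ n, C n →ₗ[ℝ] C (n + 2)) (c : ∀ n, C n) : ∀ n, C n := fun n =>
  match n with
  | 0 => 0
  | 1 => 0
  | (m + 2) => B m (c m)

/-- The exponential `exp(B) = Σ_{k≥0} B^k/k!` acting on `Ĉ = ∏ n, C n`; in each
component the sum is finite since `B` raises degree by `2` (all terms with `k > n`
vanish in degree `n`, so the range `n + 1` suffices). -/
noncomputable def expShift2 (C : ℕ → Type) [∀ n, AddCommGroup (C n)] [∀ n, Module ℝ (C n)]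
    (B : ∀ n, C n →ₗ[ℝ] C (n + 2)) (c : ∀ n, C n) : ∀ n, C n := fun n =>
  ∑ k ∈ Finset.range (n + 1), ((k.factorial : ℝ))⁻¹ • ((shift2 C B)^[k] c n)

/-- The family `E = δ ∘ B − B ∘ δ : C^n → C^{n+3}`. -/
def commE (C : ℕ → Type) [∀ n, AddCommGroup (C n)] [∀ n, Module ℝ (C n)]
    (δ : ∀ n, C n →ₗ[ℝ] C (n + 1)) (B : ∀ n, C n →ₗ[ℝ] C (n + 2)) :
    ∀ n, C n →ₗ[ℝ] C (n + 3) := fun n =>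
  (δ (n + 2)).comp (B n) - (B (n + 1)).comp (δ n)

section GradedProduct

open PowerSeries

variable {C : ℕ → Type} [∀ n, AddCommGroup (C n)] [∀ n, Module ℝ (C n)]

/-- `twistedD` as a linear endomorphism of the completion. -/
def twistedDLin (δ : ∀ n, C n →ₗ[ℝ] C (n + 1)) (η : ∀ n, C n →ₗ[ℝ] C (n + 3)) :
    Module.End ℝ (∀ n, C n) where
  toFun := twistedD C δ η
  map_add' a b := by
    funext n
    rcases n with _ | _ | _ | n <;> simp [twistedD]
    abel
  map_smul' r a := by
    funext n
    rcases n with _ | _ | _ | n <;> simp [twistedD]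

/-- `shift2` as a linear endomorphism of the completion. -/
def shift2Lin (B : ∀ n, C n →ₗ[ℝ] C (n + 2)) : Module.End ℝ (∀ n, C n) where
  toFun := shift2 C B
  map_add' a b := by
    funext n
    rcases n with _ | _ | n <;> simp [shift2]
  map_smul' r a := by
    funext n
    rcases n with _ | _ | n <;> simp [shift2]

variable (C) in
/-- The elements of the completion that vanish in all degrees `≤ n`. -/
def vanishingUpTo (n : ℕ) : Submodule ℝ (∀ n, C n) where
  carrier := {c | ∀ i ≤ n, c i = 0}
  add_mem' ha hb i hi := by simp [ha i hi, hb i hi]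
  zero_mem' _ _ := rfl
  smul_mem' r c hc i hi := by simp [hc i hi]

theorem twistedDLin_mem_vanishingUpTo (δ : ∀ n, C n →ₗ[ℝ] C (n + 1))
    (η : ∀ n, C n →ₗ[ℝ] C (n + 3)) {n : ℕ} {c : ∀ n, C n} (hc : c ∈ vanishingUpTo C n) :
    twistedDLin δ η c ∈ vanishingUpTo C n := by
  intro i hi
  change twistedD C δ η c i = 0
  rcases i with _ | _ | _ | i
  · rfl
  · simp [twistedD, hc 0 (by omega)]
  · simp [twistedD, hc 1 (by omega)]
  · simp [twistedD, hc i (by omega), hc (i + 2) (by omega)]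

theorem shift2Lin_mem_vanishingUpTo (B : ∀ n, C n →ₗ[ℝ] C (n + 2)) {n : ℕ} {c : ∀ n, C n}
    (hc : c ∈ vanishingUpTo C n) : shift2Lin B c ∈ vanishingUpTo C n := by
  intro i hi
  change shift2 C B c i = 0
  rcases i with _ | _ | i
  · rfl
  · rfl
  · simp [shift2, hc i (by omega)]

theorem shift2Lin_pow_apply_eq_zero (B : ∀ n, C n →ₗ[ℝ] C (n + 2)) (c : ∀ n, C n) :
    ∀ {k n : ℕ}, n < k → (shift2Lin B ^ k) c n = 0
  | 0, _, h => absurd h (Nat.not_lt_zero _)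
  | k + 1, n, h => by
    rw [pow_succ', Module.End.mul_apply]
    change shift2 C B _ n = 0
    rcases n with _ | _ | n
    · rfl
    · rfl
    · simp [shift2, shift2Lin_pow_apply_eq_zero B c (show n < k by omega)]

theorem aeval_shift2Lin_mem_vanishingUpTo (B : ∀ n, C n →ₗ[ℝ] C (n + 2)) (p : Polynomial ℝ)
    {n : ℕ} {c : ∀ n, C n} (hc : c ∈ vanishingUpTo C n) :
    Polynomial.aeval (shift2Lin B) p c ∈ vanishingUpTo C n := by
  have hpow (k : ℕ) : (shift2Lin B ^ k) c ∈ vanishingUpTo C n := by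
    induction k with
    | zero => simpa using hc
    | succ k ih =>
      rw [pow_succ', Module.End.mul_apply]
      exact shift2Lin_mem_vanishingUpTo B ih
  rw [Polynomial.aeval_eq_sum_range, LinearMap.sum_apply]
  exact Submodule.sum_mem _ fun k _ => Submodule.smul_mem _ _ (hpow k)

theorem aeval_shift2Lin_apply_congr (B : ∀ n, C n →ₗ[ℝ] C (n + 2)) {p q : Polynomial ℝ} {n : ℕ}
    (h : ∀ k ≤ n, p.coeff k = q.coeff k) (c : ∀ n, C n) :
    Polynomial.aeval (shift2Lin B) p c n = Polynomial.aeval (shift2Lin B) q c n := by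
  obtain ⟨r, hr⟩ : Polynomial.X ^ (n + 1) ∣ p - q :=
    Polynomial.X_pow_dvd_iff.2 fun k hk => by simp [h k (by omega)]
  rw [sub_eq_iff_eq_add.1 hr, map_add, map_mul, map_pow, Polynomial.aeval_X, LinearMap.add_apply,
    Module.End.mul_apply, Pi.add_apply, shift2Lin_pow_apply_eq_zero B _ n.lt_succ_self, zero_add]

/-- The action on the completion of a power series in the degree `2` operator `shift2`. -/
noncomputable def powerSeriesShift2 (B : ∀ n, C n →ₗ[ℝ] C (n + 2)) (f : ℝ⟦X⟧) :
    Module.End ℝ (∀ n, C n) :=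
  LinearMap.pi fun n =>
    LinearMap.proj n ∘ₗ Polynomial.aeval (shift2Lin B) (trunc (n + 1) f)

theorem powerSeriesShift2_apply (B : ∀ n, C n →ₗ[ℝ] C (n + 2)) (f : ℝ⟦X⟧) (c : ∀ n, C n)
    {n N : ℕ} (h : n < N) :
    powerSeriesShift2 B f c n = Polynomial.aeval (shift2Lin B) (trunc N f) c n :=
  aeval_shift2Lin_apply_congr B (fun k hk => by
    rw [coeff_trunc, coeff_trunc, if_pos (by omega), if_pos (by omega)]) c

theorem powerSeriesShift2_sub_aeval_mem (B : ∀ n, C n →ₗ[ℝ] C (n + 2)) (f : ℝ⟦X⟧)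
    (c : ∀ n, C n) {n N : ℕ} (h : n < N) :
    powerSeriesShift2 B f c - Polynomial.aeval (shift2Lin B) (trunc N f) c
      ∈ vanishingUpTo C n := fun i hi =>
  sub_eq_zero.2 (powerSeriesShift2_apply B f c (by omega))

theorem powerSeriesShift2_mul (B : ∀ n, C n →ₗ[ℝ] C (n + 2)) (f g : ℝ⟦X⟧) (c : ∀ n, C n) :
    powerSeriesShift2 B (f * g) c = powerSeriesShift2 B f (powerSeriesShift2 B g c) := by
  funext n
  have key := aeval_shift2Lin_mem_vanishingUpTo B (trunc (n + 1) f)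
    (powerSeriesShift2_sub_aeval_mem B g c n.lt_succ_self) n le_rfl
  rw [map_sub, Pi.sub_apply, sub_eq_zero] at key
  rw [powerSeriesShift2_apply B _ _ n.lt_succ_self, powerSeriesShift2_apply B f _ n.lt_succ_self,
    key, ← Module.End.mul_apply, ← map_mul]
  refine aeval_shift2Lin_apply_congr B (fun k hk => ?_) c
  rw [coeff_trunc, if_pos (by omega),
    coeff_mul_eq_coeff_trunc_mul_trunc f g (show k < n + 1 by omega),
    ← Polynomial.coe_mul, Polynomial.coeff_coe]

theorem powerSeriesShift2_one (B : ∀ n, C n →ₗ[ℝ] C (n + 2)) (c : ∀ n, C n) :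
    powerSeriesShift2 B 1 c = c := by
  funext n
  rw [powerSeriesShift2_apply B _ _ n.lt_succ_self, trunc_one, map_one, Module.End.one_apply]

theorem shift2_iterate (B : ∀ n, C n →ₗ[ℝ] C (n + 2)) (k : ℕ) (c : ∀ n, C n) :
    (shift2 C B)^[k] c = (shift2Lin B ^ k) c := by
  rw [Module.End.pow_apply]
  rfl

theorem aeval_trunc_shift2Lin_apply (B : ∀ n, C n →ₗ[ℝ] C (n + 2)) (f : ℝ⟦X⟧) (c : ∀ n, C n)
    (n N : ℕ) :
    Polynomial.aeval (shift2Lin B) (trunc N f) c n =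
      ∑ k ∈ Finset.range N, coeff k f • (shift2Lin B ^ k) c n := by
  rw [Polynomial.aeval_def, eval₂_trunc_eq_sum_range, LinearMap.sum_apply, Finset.sum_apply]
  simp [← Algebra.smul_def]

theorem expShift2_eq (B : ∀ n, C n →ₗ[ℝ] C (n + 2)) :
    expShift2 C B = powerSeriesShift2 B (exp ℝ) := by
  funext c n
  rw [powerSeriesShift2_apply B _ _ n.lt_succ_self, aeval_trunc_shift2Lin_apply]
  simp [expShift2, shift2_iterate, coeff_exp]

theorem shift2Lin_neg (B : ∀ n, C n →ₗ[ℝ] C (n + 2)) :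
    shift2Lin (fun n => -B n) = (-1 : ℝ) • shift2Lin B := by
  refine LinearMap.ext fun c => funext fun n => ?_
  rcases n with _ | _ | n <;> simp [shift2Lin, shift2]

theorem expShift2_neg_eq (B : ∀ n, C n →ₗ[ℝ] C (n + 2)) :
    expShift2 C (fun n => -B n) = powerSeriesShift2 B (evalNegHom (exp ℝ)) := by
  funext c n
  rw [powerSeriesShift2_apply B _ _ n.lt_succ_self, aeval_trunc_shift2Lin_apply]
  refine Finset.sum_congr rfl fun k _ => ?_
  rw [shift2_iterate, shift2Lin_neg, smul_pow, evalNegHom, coeff_rescale, coeff_exp]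
  simp [smul_smul, mul_comm]

theorem mul_aeval_eq_of_commutator {R A : Type*} [CommRing R] [Ring A] [Algebra R A] {D S F : A}
    (hDS : D * S = S * D + F) (hFS : F * S = S * F) (p : Polynomial R) :
    D * Polynomial.aeval S p =
      Polynomial.aeval S p * D + Polynomial.aeval S (Polynomial.derivative p) * F := by
  induction p using Polynomial.induction_on with
  | C a => simp [Algebra.commutes]
  | add p q hp hq => simp only [map_add, mul_add, add_mul, hp, hq]; abel
  | monomial n a ih =>
    rw [pow_succ, ← mul_assoc]
    generalize Polynomial.C a * Polynomial.X ^ n = q at ih ⊢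
    rw [Polynomial.derivative_mul, Polynomial.derivative_X, mul_one, map_mul, map_add,
      map_mul, Polynomial.aeval_X, ← mul_assoc, ih, add_mul, mul_assoc _ D S, hDS,
      mul_assoc _ F S, hFS]
    noncomm_ring

theorem twistedDLin_mul_shift2Lin {δ : ∀ n, C n →ₗ[ℝ] C (n + 1)} {η : ∀ n, C n →ₗ[ℝ] C (n + 3)}
    {B : ∀ n, C n →ₗ[ℝ] C (n + 2)}
    (hηB : ∀ n (x : C n), η (n + 2) (B n x) = B (n + 3) (η n x)) :
    twistedDLin δ η * shift2Lin B =
      shift2Lin B * twistedDLin δ η + twistedDLin 0 (commE C δ B) := by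
  refine LinearMap.ext fun c => funext fun n => ?_
  rcases n with _ | _ | _ | _ | _ | n <;>
    simp [twistedDLin, shift2Lin, twistedD, shift2, commE, hηB]
  abel

theorem twistedDLin_zero_mul_shift2Lin {E : ∀ n, C n →ₗ[ℝ] C (n + 3)}
    {B : ∀ n, C n →ₗ[ℝ] C (n + 2)}
    (hEB : ∀ n (x : C n), E (n + 2) (B n x) = B (n + 3) (E n x)) :
    twistedDLin 0 E * shift2Lin B = shift2Lin B * twistedDLin 0 E := by
  refine LinearMap.ext fun c => funext fun n => ?_
  rcases n with _ | _ | _ | _ | _ | n <;>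
    simp [twistedDLin, shift2Lin, twistedD, shift2, hEB]

theorem twistedDLin_add (δ : ∀ n, C n →ₗ[ℝ] C (n + 1)) (η E : ∀ n, C n →ₗ[ℝ] C (n + 3)) :
    twistedDLin δ (fun n => η n + E n) = twistedDLin δ η + twistedDLin 0 E := by
  refine LinearMap.ext fun c => funext fun n => ?_
  rcases n with _ | _ | _ | n <;> simp [twistedDLin, twistedD, add_assoc]

theorem twistedDLin_expShift2 {δ : ∀ n, C n →ₗ[ℝ] C (n + 1)} {η : ∀ n, C n →ₗ[ℝ] C (n + 3)}
    {B : ∀ n, C n →ₗ[ℝ] C (n + 2)}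
    (hηB : ∀ n (x : C n), η (n + 2) (B n x) = B (n + 3) (η n x))
    (hEB : ∀ n (x : C n), commE C δ B (n + 2) (B n x) = B (n + 3) (commE C δ B n x))
    (c : ∀ n, C n) :
    twistedD C δ η (expShift2 C B c) =
      expShift2 C B (twistedD C δ (fun n => η n + commE C δ B n) c) := by
  change twistedDLin δ η _ = expShift2 C B (twistedDLin δ _ c)
  rw [expShift2_eq, twistedDLin_add, LinearMap.add_apply, map_add]
  funext n
  have hn : n < n + 1 + 1 := by omega
  have key := twistedDLin_mem_vanishingUpTo δ η
    (powerSeriesShift2_sub_aeval_mem B (exp ℝ) c hn) n le_rfl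
  rw [map_sub, Pi.sub_apply, sub_eq_zero] at key
  have hderiv : Polynomial.derivative (trunc (n + 1 + 1) (exp ℝ)) = trunc (n + 1) (exp ℝ) := by
    rw [← trunc_derivative, derivative_exp]
  rw [key, ← Module.End.mul_apply, mul_aeval_eq_of_commutator (twistedDLin_mul_shift2Lin hηB)
    (twistedDLin_zero_mul_shift2Lin hEB), hderiv, Pi.add_apply,
    powerSeriesShift2_apply B _ _ hn, powerSeriesShift2_apply B _ _ n.lt_succ_self]
  rfl

theorem twistedD_twistedD {δ : ∀ n, C n →ₗ[ℝ] C (n + 1)} {η : ∀ n, C n →ₗ[ℝ] C (n + 3)}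
    (hδδ : ∀ n (x : C n), δ (n + 1) (δ n x) = 0)
    (hδη : ∀ n (x : C n), δ (n + 3) (η n x) = - η (n + 1) (δ n x))
    (hηη : ∀ n (x : C n), η (n + 3) (η n x) = 0) (c : ∀ n, C n) :
    twistedD C δ η (twistedD C δ η c) = 0 := by
  funext n
  rcases n with _ | _ | _ | _ | _ | _ | n <;> simp [twistedD, hδδ, hδη, hηη]

end GradedProduct

/-- Abstract form of Lemma 2.12 of the paper: for a twisted complex `(C, δ, η)` and a
degree `+2` family `B` with `E := δB − Bδ`, `ηB = Bη` and `EB = BE`, the operator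
`exp(B)` is a well-defined `ℝ`-linear automorphism of `Ĉ` with two-sided inverse
`exp(−B)`; it satisfies `(δ + η) ∘ exp(B) = exp(B) ∘ (δ + η + E)`; consequently
`(δ + η + E)² = 0` and `exp(B)` induces an isomorphism
`ker(δ+η+E)/im(δ+η+E) ≅ ker(δ+η)/im(δ+η)`. -/
theorem exp_twisting_isomorphism
    (C : ℕ → Type) [∀ n, AddCommGroup (C n)] [∀ n, Module ℝ (C n)]
    (δ : ∀ n, C n →ₗ[ℝ] C (n + 1)) (η : ∀ n, C n →ₗ[ℝ] C (n + 3))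
    (hδδ : ∀ n (x : C n), δ (n + 1) (δ n x) = 0)
    (hδη : ∀ n (x : C n), δ (n + 3) (η n x) = - η (n + 1) (δ n x))
    (hηη : ∀ n (x : C n), η (n + 3) (η n x) = 0)
    (B : ∀ n, C n →ₗ[ℝ] C (n + 2))
    (hηB : ∀ n (x : C n), η (n + 2) (B n x) = B (n + 3) (η n x))
    (hEB : ∀ n (x : C n),
      commE C δ B (n + 2) (B n x) = B (n + 3) (commE C δ B n x)) :
    -- (i) `exp(B)` is an `ℝ`-linear automorphism of `Ĉ` with inverse `exp(−B)`
    ((∀ a b : ∀ n, C n, expShift2 C B (a + b) = expShift2 C B a + expShift2 C B b) ∧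
     (∀ (r : ℝ) (a : ∀ n, C n), expShift2 C B (r • a) = r • expShift2 C B a) ∧
     Function.LeftInverse (expShift2 C fun n => -(B n)) (expShift2 C B) ∧
     Function.RightInverse (expShift2 C fun n => -(B n)) (expShift2 C B)) ∧
    -- (ii) `(δ + η) ∘ exp(B) = exp(B) ∘ (δ + η + E)`
    (∀ c : ∀ n, C n,
      twistedD C δ η (expShift2 C B c)
        = expShift2 C B (twistedD C δ (fun n => η n + commE C δ B n) c)) ∧
    -- (iii) `(δ + η + E)² = 0` ...
    (∀ c : ∀ n, C n,
      twistedD C δ (fun n => η n + commE C δ B n)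
        (twistedD C δ (fun n => η n + commE C δ B n) c) = 0) ∧
    -- ... and `exp(B)` induces an isomorphism on twisted cohomology:
    (∀ c : ∀ n, C n, twistedD C δ (fun n => η n + commE C δ B n) c = 0 →
      twistedD C δ η (expShift2 C B c) = 0) ∧
    (∀ c : ∀ n, C n, twistedD C δ (fun n => η n + commE C δ B n) c = 0 →
      (∃ b, twistedD C δ η b = expShift2 C B c) →
      ∃ b', twistedD C δ (fun n => η n + commE C δ B n) b' = c) ∧
    (∀ z : ∀ n, C n, twistedD C δ η z = 0 →
      ∃ c, twistedD C δ (fun n => η n + commE C δ B n) c = 0 ∧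
        ∃ b, twistedD C δ η b = z - expShift2 C B c) := by
  have hexp := expShift2_eq B
  have hinj : Function.LeftInverse (expShift2 C fun n => -(B n)) (expShift2 C B) := fun c => by
    rw [expShift2_neg_eq, hexp, ← powerSeriesShift2_mul, mul_comm, PowerSeries.exp_mul_exp_neg_eq_one,
      powerSeriesShift2_one]
  have hsurj : Function.RightInverse (expShift2 C fun n => -(B n)) (expShift2 C B) := fun c => by
    rw [expShift2_neg_eq, hexp, ← powerSeriesShift2_mul, PowerSeries.exp_mul_exp_neg_eq_one,
      powerSeriesShift2_one]
  have hD := twistedDLin_expShift2 hηB hEB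
  have hzero : expShift2 C B 0 = 0 := by rw [hexp, map_zero]
  have hDzero : twistedD C δ η 0 = 0 := map_zero (twistedDLin δ η)
  refine ⟨⟨fun a b => by rw [hexp, map_add], fun r a => by rw [hexp, map_smul], hinj, hsurj⟩,
    hD, fun c => hinj.injective ?_, fun c hc => by rw [hD, hc, hzero], ?_, ?_⟩
  · rw [← hD, ← hD, twistedD_twistedD hδδ hδη hηη, hzero]
  · rintro c - ⟨b, hb⟩
    refine ⟨expShift2 C (fun n => -(B n)) b, hinj.injective ?_⟩
    rw [← hD, hsurj b, hb]
  · intro z hz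
    refine ⟨expShift2 C (fun n => -(B n)) z, hinj.injective ?_, 0, ?_⟩
    · rw [← hD, hsurj z, hz, hzero]
    · rw [hsurj z, sub_self, hDzero]
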